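/- Let W be a Coxeter group acting on a set of cosets W/W_P, let w ∈ W and let v be the minimal length representative of a coset. If u, v ∈ W are odd-symplectic signed permutations (type C_{n+1}) with u(1) = 1, then setting u' := (u · v)v^{-1} (ordinary group product, · the Hecke product), one has u' ≤ u in Bruhat order, u'v = u · v, and u'(1) = 1; consequently u · v is odd-symplectic. -/

import Mathlib

def bar (n : ℕ) (i : Fin (2*n+2)) : Fin (2*n+2) := ⟨2*n+1 - i, by have := i.isLt; omega⟩

def IsSigned (n : ℕ) (w : Equiv.Perm (Fin (2*n+2))) : Prop :=
  ∀ i, w (bar n i) = bar n (w i)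

def IsOddSymp (n : ℕ) (w : Equiv.Perm (Fin (2*n+2))) : Prop :=
  ∀ j : Fin (2*n+2), (j : ℕ) < n+1 → (w j : ℕ) ≠ 2*n+1

def sgen (n : ℕ) (i : Fin (n+1)) : Equiv.Perm (Fin (2*n+2)) :=
  if h : (i : ℕ) < n then
    (Equiv.swap ⟨i, by omega⟩ ⟨(i : ℕ)+1, by omega⟩) *
      (Equiv.swap ⟨2*n - i, by omega⟩ ⟨2*n+1 - i, by omega⟩)
  else Equiv.swap ⟨n, by omega⟩ ⟨n+1, by omega⟩

noncomputable def len (n : ℕ) (w : Equiv.Perm (Fin (2*n+2))) : ℕ :=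
  sInf {m | ∃ l : List (Fin (n+1)), l.length = m ∧ (l.map (sgen n)).prod = w}

def WP (n k : ℕ) : Subgroup (Equiv.Perm (Fin (2*n+2))) :=
  Subgroup.closure {x | ∃ i : Fin (n+1), (i : ℕ) ≠ k - 1 ∧ x = sgen n i}

noncomputable def IsMinRep (n k : ℕ) (w : Equiv.Perm (Fin (2*n+2))) : Prop :=
  ∀ p ∈ WP n k, len n w ≤ len n (w * p)

noncomputable def cosetLen (n k : ℕ) (w : Equiv.Perm (Fin (2*n+2))) : ℕ :=
  sInf {m | ∃ p ∈ WP n k, len n (w * p) = m}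

def s2t1 (n : ℕ) : Equiv.Perm (Fin (2*n+2)) := Equiv.swap ⟨0, by omega⟩ ⟨2*n+1, by omega⟩

def st1t2 (n : ℕ) : Equiv.Perm (Fin (2*n+2)) :=
  Equiv.swap ⟨0, by omega⟩ ⟨2*n, by omega⟩ * Equiv.swap ⟨1, by omega⟩ ⟨2*n+1, by omega⟩

/-- Bruhat order via the subword property. -/
noncomputable def BruhatLe (n : ℕ) (u w : Equiv.Perm (Fin (2*n+2))) : Prop :=
  ∃ l : List (Fin (n+1)), (l.map (sgen n)).prod = w ∧ l.length = len n w ∧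
    ∃ l' : List (Fin (n+1)), l'.Sublist l ∧ (l'.map (sgen n)).prod = u

lemma sgen_val (n : ℕ) (i : Fin (n+1)) (x : Fin (2*n+2)) :
    ((sgen n i x : Fin (2*n+2)) : ℕ) =
      if (x : ℕ) = i then (i : ℕ) + 1 else if (x : ℕ) = i + 1 then (i : ℕ)
      else if (x : ℕ) = 2*n - i then 2*n+1-i else if (x : ℕ) = 2*n+1-i then 2*n - i else x := by
  have hi := i.isLt
  have hx := x.isLt
  unfold sgen
  split_ifs <;> simp only [Equiv.Perm.mul_apply, Equiv.swap_apply_def, Fin.ext_iff, apply_ite Fin.val] <;>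
    (repeat' split_ifs) <;> (try simp only [] at *) <;> omega

lemma bar_val (n : ℕ) (x : Fin (2*n+2)) : ((bar n x : Fin (2*n+2)) : ℕ) = 2*n+1 - x := rfl

lemma sgen_signed (n : ℕ) (i : Fin (n+1)) : IsSigned n (sgen n i) := by
  intro x
  apply Fin.ext
  have hi := i.isLt
  have hx := x.isLt
  rw [bar_val, sgen_val, sgen_val, bar_val]
  split_ifs <;> omega

lemma sgen_sq (n : ℕ) (i : Fin (n+1)) : sgen n i * sgen n i = 1 := by
  ext x
  have hi := i.isLt
  have hx := x.isLt
  rw [Equiv.Perm.mul_apply, Equiv.Perm.one_apply, sgen_val, sgen_val]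
  split_ifs <;> omega

lemma signed_mul {n : ℕ} {a b : Equiv.Perm (Fin (2*n+2))} (ha : IsSigned n a)
    (hb : IsSigned n b) : IsSigned n (a * b) := by
  intro x
  rw [Equiv.Perm.mul_apply, Equiv.Perm.mul_apply, hb, ha]

lemma signed_one (n : ℕ) : IsSigned n 1 := fun _ => rfl

lemma signed_prod (n : ℕ) (l : List (Fin (n+1))) : IsSigned n (l.map (sgen n)).prod := by
  induction l with
  | nil => exact signed_one n
  | cons a l ih => simpa using signed_mul (sgen_signed n a) ih

lemma sgen_zero_aux (n : ℕ) (i : Fin (n+1)) (h : (i : ℕ) ≠ 0) (x : Fin (2*n+2)) (hx : (x : ℕ) = 0) :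
    sgen n i x = x := by
  apply Fin.ext
  rw [sgen_val]
  have := i.isLt
  split_ifs <;> omega

lemma sgen_zero (n : ℕ) (i : Fin (n+1)) (h : (i : ℕ) ≠ 0) :
    sgen n i ⟨0, by omega⟩ = ⟨0, by omega⟩ := sgen_zero_aux n i h _ rfl

/-- position `i` -/
def lo (n : ℕ) (i : Fin (n+1)) : Fin (2*n+2) := ⟨i, by omega⟩
/-- position `i+1` -/
def hi (n : ℕ) (i : Fin (n+1)) : Fin (2*n+2) := ⟨i + 1, by omega⟩

lemma sgen_lo (n : ℕ) (i : Fin (n+1)) : sgen n i (lo n i) = hi n i := by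
  apply Fin.ext; rw [sgen_val]; simp [lo, hi]

lemma sgen_hi (n : ℕ) (i : Fin (n+1)) : sgen n i (hi n i) = lo n i := by
  apply Fin.ext; rw [sgen_val]; simp [lo, hi]

lemma bar_bar (n : ℕ) (x : Fin (2*n+2)) : bar n (bar n x) = x := by
  apply Fin.ext; rw [bar_val, bar_val]; omega

lemma sgen_other (n : ℕ) (i : Fin (n+1)) (x : Fin (2*n+2)) (h1 : x ≠ lo n i) (h2 : x ≠ hi n i)
    (h3 : x ≠ bar n (lo n i)) (h4 : x ≠ bar n (hi n i)) : sgen n i x = x := by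
  apply Fin.ext; rw [sgen_val]
  rw [Ne, Fin.ext_iff] at h1 h2 h3 h4
  simp only [bar_val, lo, hi] at *
  split_ifs <;> omega

lemma conj_aux {n : ℕ} {w : Equiv.Perm (Fin (2*n+2))} (hw : IsSigned n w) (i a : Fin (n+1))
    (h : (w (lo n i) = lo n a ∧ w (hi n i) = hi n a) ∨
      (w (lo n i) = bar n (hi n a) ∧ w (hi n i) = bar n (lo n a))) :
    w * sgen n i = sgen n a * w := by
  have e1 := hw (lo n i)
  have e2 := hw (hi n i)
  have g1 := sgen_signed n i (lo n i)
  have g2 := sgen_signed n i (hi n i)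
  have k1 := sgen_signed n a (lo n a)
  have k2 := sgen_signed n a (hi n a)
  rw [sgen_lo] at g1 k1
  rw [sgen_hi] at g2 k2
  ext1 x
  rw [Equiv.Perm.mul_apply, Equiv.Perm.mul_apply]
  by_cases h1 : x = lo n i
  · subst h1
    rw [sgen_lo]
    rcases h with ⟨p, q⟩ | ⟨p, q⟩
    · rw [p, q, sgen_lo]
    · rw [p, q, k2]
  by_cases h2 : x = hi n i
  · subst h2
    rw [sgen_hi]
    rcases h with ⟨p, q⟩ | ⟨p, q⟩
    · rw [p, q, sgen_hi]
    · rw [p, q, k1]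
  by_cases h3 : x = bar n (lo n i)
  · subst h3
    rw [g1, e1, e2]
    rcases h with ⟨p, q⟩ | ⟨p, q⟩
    · rw [p, q, k1]
    · rw [p, q, bar_bar, bar_bar, sgen_hi]
  by_cases h4 : x = bar n (hi n i)
  · subst h4
    rw [g2, e1, e2]
    rcases h with ⟨p, q⟩ | ⟨p, q⟩
    · rw [p, q, k2]
    · rw [p, q, bar_bar, bar_bar, sgen_lo]
  rw [sgen_other n i x h1 h2 h3 h4]
  have m1 := w.injective.ne h1
  have m2 := w.injective.ne h2
  have m3 := w.injective.ne h3
  have m4 := w.injective.ne h4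
  rw [e1] at m3
  rw [e2] at m4
  rcases h with ⟨p, q⟩ | ⟨p, q⟩
  · rw [p] at m1 m3
    rw [q] at m2 m4
    rw [sgen_other n a _ m1 m2 m3 m4]
  · rw [p] at m1 m3
    rw [q] at m2 m4
    rw [bar_bar] at m3 m4
    rw [sgen_other n a _ m4 m3 m2 m1]

lemma sgen_flip (n : ℕ) (a : Fin (n+1)) (p q : Fin (2*n+2)) (hpq : p < q)
    (h : sgen n a q < sgen n a p) :
    (p = lo n a ∧ q = hi n a) ∨ (p = bar n (hi n a) ∧ q = bar n (lo n a)) := by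
  rw [Fin.lt_def, sgen_val, sgen_val] at h
  rw [Fin.lt_def] at hpq
  simp only [Fin.ext_iff, bar_val, lo, hi]
  have := a.isLt
  have := p.isLt
  have := q.isLt
  split_ifs at h <;> omega

lemma flip2 {n : ℕ} {v : Equiv.Perm (Fin (2*n+2))} (hv : IsSigned n v) (i : Fin (n+1))
    (hvi : v (lo n i) < v (hi n i)) (l : List (Fin (n+1)))
    (hl : ((l.map (sgen n)).prod * v) (hi n i) < ((l.map (sgen n)).prod * v) (lo n i)) :
    ∃ l' : List (Fin (n+1)), l'.Sublist l ∧ l'.length < l.length ∧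
      (l'.map (sgen n)).prod * v = (l.map (sgen n)).prod * v * sgen n i := by
  induction l with
  | nil =>
    simp at hl
    exact absurd hl (not_lt.mpr hvi.le)
  | cons a l ih =>
    by_cases hc : ((l.map (sgen n)).prod * v) (hi n i) < ((l.map (sgen n)).prod * v) (lo n i)
    · obtain ⟨l', h1, h2, h3⟩ := ih hc
      refine ⟨a :: l', h1.cons_cons a, by simpa using h2, ?_⟩
      simp only [List.map_cons, List.prod_cons, mul_assoc] at h3 ⊢
      rw [h3]
    · refine ⟨l, List.sublist_cons_self a l, by simp, ?_⟩
      have hs := signed_mul (signed_prod n l) hv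
      set w := (l.map (sgen n)).prod * v with hwdef
      have hne : w (lo n i) ≠ w (hi n i) := w.injective.ne (by simp [lo, hi])
      have hlt : w (lo n i) < w (hi n i) := lt_of_le_of_ne (not_lt.mp hc) hne
      simp only [List.map_cons, List.prod_cons, mul_assoc] at hl ⊢
      rw [← mul_assoc _ v, ← hwdef] 
      rw [← hwdef, Equiv.Perm.mul_apply, Equiv.Perm.mul_apply] at hl
      have := conj_aux hs i a (sgen_flip n a _ _ hlt hl)
      rw [this, ← mul_assoc, sgen_sq, one_mul]

lemma flip1 {n : ℕ} (i : Fin (n+1)) (l : List (Fin (n+1)))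
    (hl : (l.map (sgen n)).prod (hi n i) < (l.map (sgen n)).prod (lo n i)) :
    ∃ l' : List (Fin (n+1)), l'.Sublist l ∧ l'.length < l.length ∧
      (l'.map (sgen n)).prod = (l.map (sgen n)).prod * sgen n i := by
  simpa using flip2 (signed_one n) i (by simp [lo, hi, Fin.lt_def]) l (by simpa using hl)

lemma len_le (n : ℕ) (l : List (Fin (n+1))) : len n (l.map (sgen n)).prod ≤ l.length :=
  Nat.sInf_le ⟨l, rfl, rfl⟩

lemma no_desc {n : ℕ} {w : Equiv.Perm (Fin (2*n+2))} (hw : IsSigned n w)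
    (h : ∀ i, ¬ w (hi n i) < w (lo n i)) : w = 1 := by
  have h' : ∀ i, w (lo n i) < w (hi n i) := fun i =>
    lt_of_le_of_ne (not_lt.mp (h i)) (w.injective.ne (by simp [lo, hi]))
  have hm : StrictMono (w : Fin (2*n+1+1) → Fin (2*n+1+1)) := by
    rw [Fin.strictMono_iff_lt_succ]
    intro x
    by_cases hx : (x : ℕ) ≤ n
    · exact h' ⟨x, by omega⟩
    · have hlt := x.isLt
      have := h' ⟨2*n - x, by omega⟩
      have e1 := hw (lo n ⟨2*n - x, by omega⟩)
      have e2 := hw (hi n ⟨2*n - x, by omega⟩)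
      have f1 : bar n (lo n ⟨2*n - x, by omega⟩) = x.succ := by
        apply Fin.ext; rw [bar_val]; simp [lo]; omega
      have f2 : bar n (hi n ⟨2*n - x, by omega⟩) = x.castSucc := by
        apply Fin.ext; rw [bar_val]; simp [hi]; omega
      rw [f1] at e1
      rw [f2] at e2
      rw [e1, e2, Fin.lt_def, bar_val, bar_val]
      rw [Fin.lt_def] at this
      omega
  have := (StrictMono.range_inj hm strictMono_id).mp (by simp [w.surjective.range_eq])
  ext x
  have := congrFun this x
  rw [this]; rfl

lemma exists_reduced {n : ℕ} (w : Equiv.Perm (Fin (2*n+2))) (hw : IsSigned n w) :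
    ∃ l : List (Fin (n+1)), (l.map (sgen n)).prod = w ∧ l.length = len n w ∧
      (w ⟨0, by omega⟩ = ⟨0, by omega⟩ → ∀ i ∈ l, (i : ℕ) ≠ 0) := by
  induction hf : toLex (fun x => w x) using WellFoundedLT.induction generalizing w with
  | ind f ih =>
  by_cases h : ∀ i, ¬ w (hi n i) < w (lo n i)
  · have h1 := no_desc hw h
    refine ⟨[], by simp [h1], ?_, by simp⟩
    have := len_le n []
    subst h1
    simp at this
    simp [this]
  · push Not at h
    obtain ⟨i, hi'⟩ := h
    have hs := signed_mul hw (sgen_signed n i)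
    have hlt : toLex (fun x => (w * sgen n i) x) < f := by
      subst hf
      refine ⟨lo n i, ?_, ?_⟩
      · intro j hj
        have : sgen n i j = j := by
          apply Fin.ext
          rw [sgen_val]
          rw [Fin.lt_def] at hj
          simp only [lo] at hj
          have := i.isLt
          split_ifs <;> omega
        simp [this]
      · simpa [sgen_lo] using hi'
    obtain ⟨l, h1, h2, h3⟩ := ih _ hlt _ hs rfl
    have hp : ((l ++ [i]).map (sgen n)).prod = w := by
      simp [h1, mul_assoc, sgen_sq]
    refine ⟨l ++ [i], hp, ?_, ?_⟩
    · apply le_antisymm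
      · have hmem : len n w ∈ {m | ∃ l : List (Fin (n+1)), l.length = m ∧
            (l.map (sgen n)).prod = w} := Nat.sInf_mem ⟨_, l ++ [i], rfl, hp⟩
        obtain ⟨k, k1, k2⟩ := hmem
        obtain ⟨k', _, k3, k4⟩ := flip1 i k (by rw [k2]; exact hi')
        have := len_le n k'
        rw [k4, k2] at this
        simp
        omega
      · have := len_le n (l ++ [i])
        rwa [hp] at this
    · intro h0 j hj
      have hi0 : (i : ℕ) ≠ 0 := by
        intro hi0
        have : lo n i = ⟨0, by omega⟩ := by apply Fin.ext; simpa [lo] using hi0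
        rw [this, h0, Fin.lt_def] at hi'
        simp at hi'
      rw [List.mem_append] at hj
      rcases hj with hj | hj
      · refine h3 ?_ j hj
        have : sgen n i ⟨0, by omega⟩ = ⟨0, by omega⟩ := by
          exact sgen_zero n i hi0
        rw [Equiv.Perm.mul_apply, this, h0]
      · simp at hj
        rwa [hj]

lemma prod_fix {n : ℕ} (l : List (Fin (n+1))) (hl : ∀ i ∈ l, (i : ℕ) ≠ 0) :
    (l.map (sgen n)).prod ⟨0, by omega⟩ = ⟨0, by omega⟩ := by
  induction l with
  | nil => rfl
  | cons i l ih =>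
    rw [List.map_cons, List.prod_cons, Equiv.Perm.mul_apply,
      ih (fun j hj => hl j (List.mem_cons_of_mem _ hj))]
    exact sgen_zero n i (hl i List.mem_cons_self)

lemma desc_of_not_lt {n : ℕ} {w : Equiv.Perm (Fin (2*n+2))} (hw : IsSigned n w) (i : Fin (n+1))
    (h : ¬ len n w < len n (w * sgen n i)) : w (hi n i) < w (lo n i) := by
  by_contra hc
  have hlt : w (lo n i) < w (hi n i) :=
    lt_of_le_of_ne (not_lt.mp hc) (w.injective.ne (by simp [lo, hi]))
  obtain ⟨k, k1, k2, _⟩ := exists_reduced _ (signed_mul hw (sgen_signed n i))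
  obtain ⟨k', _, k3, k4⟩ := flip1 i k (by
    rw [k1]; simpa [sgen_lo, sgen_hi] using hlt)
  rw [k1, mul_assoc, sgen_sq, mul_one] at k4
  have := len_le n k'
  rw [k4] at this
  omega


/-- Let `u, v` be odd-symplectic signed permutations of type `C_{n+1}` with `u(1) = 1`,
and let `·` be the Hecke product.  Setting `u' := (u · v)v⁻¹`, one has `u' ≤ u` in
Bruhat order, `u'v = u · v`, and `u'(1) = 1`; consequently `u · v` is odd-symplectic. -/
theorem stmt16 (n : ℕ)
    (h : Equiv.Perm (Fin (2*n+2)) → Equiv.Perm (Fin (2*n+2)) → Equiv.Perm (Fin (2*n+2)))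
    (hclosed : ∀ a b, IsSigned n a → IsSigned n b → IsSigned n (h a b))
    (hassoc : ∀ a b c, IsSigned n a → IsSigned n b → IsSigned n c →
      h (h a b) c = h a (h b c))
    (hone : ∀ a, IsSigned n a → h a 1 = a)
    (hsimp : ∀ w i, IsSigned n w →
      h w (sgen n i) = if len n w < len n (w * sgen n i) then w * sgen n i else w)
    (u v : Equiv.Perm (Fin (2*n+2)))
    (hu : IsSigned n u) (hv : IsSigned n v)
    (hou : IsOddSymp n u) (hov : IsOddSymp n v)
    (hu1 : u ⟨0, by omega⟩ = ⟨0, by omega⟩) :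
    BruhatLe n (h u v * v⁻¹) u ∧
      (h u v * v⁻¹) * v = h u v ∧
      (h u v * v⁻¹) ⟨0, by omega⟩ = ⟨0, by omega⟩ ∧
      IsOddSymp n (h u v) := by
  obtain ⟨l, l1, l2, l3⟩ := exists_reduced u hu
  have key : ∀ m : List (Fin (n+1)), m.length = len n (m.map (sgen n)).prod →
      ∃ l' : List (Fin (n+1)), l'.Sublist l ∧
        (l'.map (sgen n)).prod * (m.map (sgen n)).prod = h u (m.map (sgen n)).prod := by
    intro m
    induction m using List.reverseRecOn with
    | nil =>
      intro _
      exact ⟨l, List.Sublist.refl l, by simp [l1, hone u hu]⟩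
    | append_singleton m i ih =>
      intro hm
      have hsm := signed_prod n m
      have hmi : ((m ++ [i]).map (sgen n)).prod = (m.map (sgen n)).prod * sgen n i := by simp
      rw [hmi] at hm ⊢
      have hm1 := len_le n m
      have hred : m.length = len n (m.map (sgen n)).prod := by
        obtain ⟨k, k1, k2, _⟩ := exists_reduced _ hsm
        have := len_le n (k ++ [i])
        have hki : ((k ++ [i]).map (sgen n)).prod = (m.map (sgen n)).prod * sgen n i := by
          simp [k1]
        rw [hki, ← hm] at this
        simp at this
        omega
      obtain ⟨l', s1, s2⟩ := ih hred
      set v' := (m.map (sgen n)).prod with hv'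
      have hlt : len n v' < len n (v' * sgen n i) := by
        rw [← hm, ← hred]; simp
      have e1 : h u (v' * sgen n i) = h (h u v') (sgen n i) := by
        rw [hassoc u v' _ hu hsm (sgen_signed n i), hsimp v' i hsm, if_pos hlt]
      have hs' := signed_mul (signed_prod n l') hsm
      rw [e1, ← s2, hsimp _ i hs']
      split_ifs with hc
      · exact ⟨l', s1, (mul_assoc _ _ _).symm⟩
      · have hd := desc_of_not_lt hs' i hc
        have hasc : v' (lo n i) < v' (hi n i) := by
          by_contra hcon
          have hlt' : v' (hi n i) < v' (lo n i) :=
            lt_of_le_of_ne (not_lt.mp hcon) (v'.injective.ne (by simp [lo, hi]))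
          obtain ⟨k', _, k3, k4⟩ := flip1 i m hlt'
          have := len_le n k'
          rw [k4, ← hv'] at this
          omega
        obtain ⟨l'', t1, _, t3⟩ := flip2 hsm i hasc l' hd
        refine ⟨l'', t1.trans s1, ?_⟩
        rw [← mul_assoc, t3, mul_assoc _ (sgen n i), sgen_sq, mul_one]
  obtain ⟨m, m1, m2, _⟩ := exists_reduced v hv
  obtain ⟨l', s1, s2⟩ := key m (by rw [m1, m2])
  rw [m1] at s2
  have hu' : h u v * v⁻¹ = (l'.map (sgen n)).prod := by
    rw [← s2, mul_assoc, mul_inv_cancel, mul_one]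
  have hfix : (l'.map (sgen n)).prod ⟨0, by omega⟩ = ⟨0, by omega⟩ :=
    prod_fix l' (fun i hi => l3 hu1 i (s1.subset hi))
  refine ⟨⟨l, l1, l2, l', s1, hu'.symm⟩, by simp, by rw [hu']; exact hfix, ?_⟩
  intro j hj hcon
  have hlast : (l'.map (sgen n)).prod ⟨2*n+1, by omega⟩ = ⟨2*n+1, by omega⟩ := by
    have := signed_prod n l' ⟨0, by omega⟩
    rw [hfix] at this
    exact this
  apply hov j hj
  have h2 : (l'.map (sgen n)).prod (v j) = (l'.map (sgen n)).prod ⟨2*n+1, by omega⟩ := by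
    rw [hlast, ← Equiv.Perm.mul_apply, s2]
    exact Fin.ext hcon
  exact congrArg Fin.val ((l'.map (sgen n)).prod.injective h2)
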